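/- If the i.i.d. nonnegative conductances have finite mean ⟨C⟩, then the limit lim_{L→∞} lim_{A→∞} W_{L,A}/(L A) exists almost surely, is finite, equals v₀² c̄^CBC, and is independent of whether open or closed boundary conditions are used, where v₀² c̄^CBC = lim_{L→∞} lim_{A→∞} E(W^CBC_{L,A})/(L A). -/

import Mathlib

open Filter MeasureTheory Topology

noncomputable section

/-- A conductance field on `ℤ²`: for each site, the conductance of the link to
the right (`.1`, longitudinal) and of the link upwards (`.2`, transverse). -/
abbrev CField := (ℤ × ℤ) → ℝ × ℝ

/-- The field of conductances is nonnegative. -/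
def nonnegField (C : CField) : Prop := ∀ p, 0 ≤ (C p).1 ∧ 0 ≤ (C p).2

/-- Dirichlet energy (dissipation) of the potential `φ` on the rectangle with
`L` longitudinal links and `A` transverse sites (rows `0,…,A-1`). -/
def netEnergy (C : CField) (L A : ℕ) (φ : ℤ × ℤ → ℝ) : ℝ :=
  (∑ i ∈ Finset.range L, ∑ j ∈ Finset.range A,
    (φ ((i : ℤ), (j : ℤ)) - φ ((i : ℤ) + 1, (j : ℤ)))^2 * (C ((i : ℤ), (j : ℤ))).1) +
  (∑ i ∈ Finset.range (L+1), ∑ j ∈ Finset.range (A-1),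
    (φ ((i : ℤ), (j : ℤ)) - φ ((i : ℤ), (j : ℤ) + 1))^2 * (C ((i : ℤ), (j : ℤ))).2)

/-- Open boundary conditions: the potential is fixed only on the two transverse
ends, to `0` and `L v₀`. -/
def obcOK (L A : ℕ) (v₀ : ℝ) (φ : ℤ × ℤ → ℝ) : Prop :=
  ∀ j ∈ Finset.range A, φ (0, (j : ℤ)) = 0 ∧ φ ((L : ℤ), (j : ℤ)) = L * v₀

/-- Closed boundary conditions: the potential is fixed to `n₁ v₀` on the whole
boundary of the rectangle. -/
def cbcOK (L A : ℕ) (v₀ : ℝ) (φ : ℤ × ℤ → ℝ) : Prop :=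
  ∀ i ∈ Finset.range (L+1), ∀ j ∈ Finset.range A,
    (i = 0 ∨ i = L ∨ j = 0 ∨ j = A - 1) → φ ((i : ℤ), (j : ℤ)) = i * v₀

/-- Total dissipation with open boundary conditions: minimal Dirichlet energy. -/
def WOBC (C : CField) (v₀ : ℝ) (L A : ℕ) : ℝ :=
  ⨅ φ : {φ : ℤ × ℤ → ℝ // obcOK L A v₀ φ}, netEnergy C L A φ.1

/-- Total dissipation with closed boundary conditions: minimal Dirichlet energy. -/
def WCBC (C : CField) (v₀ : ℝ) (L A : ℕ) : ℝ :=
  ⨅ φ : {φ : ℤ × ℤ → ℝ // cbcOK L A v₀ φ}, netEnergy C L A φ.1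

/-- Translation of the conductance field by `k` in the longitudinal direction. -/
def shiftH (k : ℤ) (C : CField) : CField := fun p => C (p.1 + k, p.2)

/-- Translation of the conductance field by `k` in the transverse direction. -/
def shiftV (k : ℤ) (C : CField) : CField := fun p => C (p.1, p.2 + k)

section Ergodic

variable {X : Type*} {T : X → X} {f : X → ℝ}

/-- The running maximum of the Birkhoff sums of orders `0, …, n`. -/
def maxBirkhoffSum (T : X → X) (f : X → ℝ) : ℕ → X → ℝ
  | 0 => fun _ => 0
  | n + 1 => fun x => max 0 (f x + maxBirkhoffSum T f n (T x))

theorem maxBirkhoffSum_nonneg (n : ℕ) (x : X) : 0 ≤ maxBirkhoffSum T f n x := by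
  cases n with
  | zero => exact le_rfl
  | succ n => exact le_max_left _ _

theorem monotone_maxBirkhoffSum (x : X) : Monotone fun n => maxBirkhoffSum T f n x := by
  refine monotone_nat_of_le_succ fun n => ?_
  induction n generalizing x with
  | zero => exact maxBirkhoffSum_nonneg 1 x
  | succ n ih =>
    have := ih (T x)
    simp only [maxBirkhoffSum] at this ⊢
    gcongr

theorem birkhoffSum_le_maxBirkhoffSum (n : ℕ) (x : X) :
    birkhoffSum T f n x ≤ maxBirkhoffSum T f n x := by
  induction n generalizing x with
  | zero => simp [maxBirkhoffSum]
  | succ n ih =>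
    rw [birkhoffSum_succ']
    exact le_max_of_le_right (by linarith [ih (T x)])

theorem bddAbove_maxBirkhoffSum_comp_iff (x : X) :
    BddAbove (Set.range fun n => maxBirkhoffSum T f n (T x)) ↔
      BddAbove (Set.range fun n => maxBirkhoffSum T f n x) := by
  constructor
  · rintro ⟨M, hM⟩
    refine ⟨max 0 (f x + M), ?_⟩
    rintro _ ⟨n, rfl⟩
    refine (monotone_maxBirkhoffSum x n.le_succ).trans ?_
    have : maxBirkhoffSum T f n (T x) ≤ M := hM ⟨n, rfl⟩
    exact max_le_max le_rfl (by linarith)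
  · rintro ⟨M, hM⟩
    refine ⟨M - f x, ?_⟩
    rintro _ ⟨n, rfl⟩
    have : maxBirkhoffSum T f (n + 1) x ≤ M := hM ⟨n + 1, rfl⟩
    have h := (le_max_right _ _).trans this
    change maxBirkhoffSum T f n (T x) ≤ _
    linarith

variable [MeasurableSpace X] {μ : Measure X}

theorem MeasureTheory.MeasurePreserving.integral_comp_of_integrable
    (hT : MeasurePreserving T μ μ) (hf : Integrable f μ) : ∫ x, f (T x) ∂μ = ∫ x, f x ∂μ := by
  have h := integral_map (μ := μ) hT.measurable.aemeasurable (f := f)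
    (by rw [hT.map_eq]; exact hf.aestronglyMeasurable)
  rw [hT.map_eq] at h
  exact h.symm

theorem measurable_maxBirkhoffSum (hT : Measurable T) (hf : Measurable f) (n : ℕ) :
    Measurable (maxBirkhoffSum T f n) := by
  induction n with
  | zero => exact measurable_const
  | succ n ih => exact measurable_const.max (hf.add (ih.comp hT))

theorem integrable_maxBirkhoffSum [IsFiniteMeasure μ] (hT : MeasurePreserving T μ μ)
    (hf : Integrable f μ) (n : ℕ) : Integrable (maxBirkhoffSum T f n) μ := by
  induction n with
  | zero => exact integrable_const 0
  | succ n ih => exact (integrable_const 0).sup (hf.add (hT.integrable_comp_of_integrable ih))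

theorem measurableSet_bddAbove_maxBirkhoffSum (hT : Measurable T) (hf : Measurable f) :
    MeasurableSet {x | BddAbove (Set.range fun n => maxBirkhoffSum T f n x)} :=
  measurableSet_bddAbove_range fun n => measurable_maxBirkhoffSum hT hf n

/-- If almost every running maximum of Birkhoff sums is unbounded, the mean is nonnegative. -/
theorem integral_nonneg_of_ae_not_bddAbove [IsFiniteMeasure μ] (hT : MeasurePreserving T μ μ)
    (hf : Integrable f μ)
    (h : ∀ᵐ x ∂μ, ¬ BddAbove (Set.range fun n => maxBirkhoffSum T f n x)) : 0 ≤ ∫ x, f x ∂μ := by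
  have hF := integrable_maxBirkhoffSum hT hf
  have hFT : ∀ n, Integrable (fun x => maxBirkhoffSum T f n (T x)) μ :=
    fun n => hT.integrable_comp_of_integrable (hF n)
  have hlim : Tendsto (fun n => ∫ x, (maxBirkhoffSum T f (n + 1) x - maxBirkhoffSum T f n (T x)) ∂μ)
      atTop (𝓝 (∫ x, f x ∂μ)) := by
    refine tendsto_integral_of_dominated_convergence (fun x => |f x|)
      (fun n => ((hF (n + 1)).sub (hFT n)).aestronglyMeasurable) hf.abs
      (fun n => ae_of_all _ fun x => ?_) ?_
    · have h0 := maxBirkhoffSum_nonneg (T := T) (f := f) n (T x)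
      simp only [maxBirkhoffSum, Real.norm_eq_abs]
      rcases le_total 0 (f x + maxBirkhoffSum T f n (T x)) with h1 | h1
      · rw [max_eq_right h1, add_sub_cancel_right]
      · rw [max_eq_left h1, abs_le]
        have := neg_abs_le (f x)
        have := abs_nonneg (f x)
        constructor <;> linarith
    · filter_upwards [h] with x hx
      rw [← bddAbove_maxBirkhoffSum_comp_iff] at hx
      have ht := tendsto_atTop_atTop_of_monotone' (monotone_maxBirkhoffSum (T x)) hx
      refine tendsto_const_nhds.congr' ?_
      filter_upwards [ht.eventually_ge_atTop (-f x)] with n hn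
      simp only [maxBirkhoffSum]
      rw [max_eq_right (by linarith), add_sub_cancel_right]
  refine ge_of_tendsto' hlim fun n => ?_
  rw [integral_sub (hF _) (hFT n), hT.integral_comp_of_integrable (hF n), sub_nonneg]
  exact integral_mono (hF _) (hF _) fun x => monotone_maxBirkhoffSum x n.le_succ

/-- Birkhoff sums of a function with negative mean are almost surely bounded above. -/
theorem Ergodic.ae_birkhoffSum_le_of_integral_neg [IsFiniteMeasure μ] (hT : Ergodic T μ)
    (hf : Integrable f μ) (hneg : ∫ x, f x ∂μ < 0) :
    ∀ᵐ x ∂μ, ∃ M, ∀ n, birkhoffSum T f n x ≤ M := by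
  wlog hfm : Measurable f generalizing f
  · have hmk := hf.aestronglyMeasurable.ae_eq_mk
    have h := this (f := hf.aestronglyMeasurable.mk f) (hf.congr hmk)
      (by rwa [← integral_congr_ae hmk]) hf.aestronglyMeasurable.stronglyMeasurable_mk.measurable
    have hsum : ∀ᵐ x ∂μ, ∀ n : ℕ, f (T^[n] x) = hf.aestronglyMeasurable.mk f (T^[n] x) :=
      ae_all_iff.2 fun n => (hT.toMeasurePreserving.iterate n).quasiMeasurePreserving.ae hmk
    filter_upwards [h, hsum] with x ⟨M, hM⟩ hx
    exact ⟨M, fun n => by simpa [birkhoffSum, hx] using hM n⟩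
  rcases hT.toPreErgodic.ae_mem_or_ae_notMem
      (measurableSet_bddAbove_maxBirkhoffSum hT.measurable hfm)
      (Set.ext bddAbove_maxBirkhoffSum_comp_iff) with h | h
  · filter_upwards [h] with x ⟨M, hM⟩
    exact ⟨M, fun n => (birkhoffSum_le_maxBirkhoffSum n x).trans (hM ⟨n, rfl⟩)⟩
  · exact absurd (integral_nonneg_of_ae_not_bddAbove hT.toMeasurePreserving hf h) hneg.not_ge

theorem Ergodic.ae_forall_eventually_birkhoffSum_div_lt [IsProbabilityMeasure μ]
    (hT : Ergodic T μ) (hf : Integrable f μ) :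
    ∀ᵐ x ∂μ, ∀ c, ∫ x, f x ∂μ < c → ∀ᶠ n : ℕ in atTop, birkhoffSum T f n x / n < c := by
  have h : ∀ᵐ x ∂μ, ∀ q : ℚ, ∫ x, f x ∂μ < q →
      ∃ M, ∀ n, birkhoffSum T (fun x => f x - q) n x ≤ M := by
    refine ae_all_iff.2 fun q => ?_
    by_cases hq : ∫ x, f x ∂μ < q
    · refine (hT.ae_birkhoffSum_le_of_integral_neg (hf.sub (integrable_const (q : ℝ))) ?_).mono
        fun x hx _ => hx
      simpa [integral_sub hf (integrable_const (q : ℝ))] using hq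
    · exact ae_of_all _ fun x hx => absurd hx hq
  filter_upwards [h] with x hx c hc
  obtain ⟨q, hq, hqc⟩ := exists_rat_btwn hc
  obtain ⟨M, hM⟩ := hx q hq
  have hlim : Tendsto (fun n : ℕ => q + M / n) atTop (𝓝 (q + 0)) :=
    tendsto_const_nhds.add (tendsto_const_nhds.div_atTop tendsto_natCast_atTop_atTop)
  rw [add_zero] at hlim
  filter_upwards [hlim.eventually (gt_mem_nhds hqc), eventually_gt_atTop 0] with n hn hn0
  refine lt_of_le_of_lt ?_ hn
  have h1 := hM n
  simp only [birkhoffSum, Finset.sum_sub_distrib, Finset.sum_const, Finset.card_range,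
    nsmul_eq_mul] at h1 ⊢
  have hn0' : (0 : ℝ) < n := by exact_mod_cast hn0
  rw [div_le_iff₀ hn0', add_mul, div_mul_cancel₀ _ hn0'.ne']
  linarith

/-- **Birkhoff's pointwise ergodic theorem**, for ergodic maps. -/
theorem Ergodic.ae_tendsto_birkhoffSum_div [IsProbabilityMeasure μ] (hT : Ergodic T μ)
    (hf : Integrable f μ) :
    ∀ᵐ x ∂μ, Tendsto (fun n : ℕ => birkhoffSum T f n x / n) atTop (𝓝 (∫ x, f x ∂μ)) := by
  filter_upwards [hT.ae_forall_eventually_birkhoffSum_div_lt hf,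
    hT.ae_forall_eventually_birkhoffSum_div_lt hf.neg] with x h1 h2
  refine tendsto_order.2 ⟨fun c hc => ?_, h1⟩
  filter_upwards [h2 (-c) (by simpa [integral_neg] using hc)] with n hn
  have : birkhoffSum T (-f) n x = - birkhoffSum T f n x := by simp [birkhoffSum]
  rw [this, neg_div] at hn
  linarith

end Ergodic

theorem Finset.sum_range_mul_add (g : ℕ → ℝ) (B q : ℕ) :
    ∑ r ∈ Finset.range B, ∑ m ∈ Finset.range q, g (r + m * B) = ∑ j ∈ Finset.range (q * B), g j := by
  induction q with
  | zero => simp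
  | succ q ih =>
    simp only [Finset.sum_range_succ, Finset.sum_add_distrib, ih]
    rw [add_mul, one_mul, Finset.sum_range_add]
    simp [add_comm]

/-- Averaging over the offset of a decomposition into blocks of length `B`. -/
theorem mul_le_block_sum {a : ℕ → ℕ → ℝ} {b : ℕ → ℝ}
    (ha : ∀ j m n, a j (m + n) ≤ a j m + a (j + m) n) (hab : ∀ j, a j 1 ≤ b j)
    (hb : ∀ j, 0 ≤ b j) (B q n : ℕ) (hn : (q + 1) * B ≤ n) :
    B * a 0 n ≤ ∑ r ∈ Finset.range B, a 0 r + ∑ j ∈ Finset.range (q * B), a j B +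
      B * (∑ k ∈ Finset.range n, b k - ∑ k ∈ Finset.range (q * B), b k) := by
  have hblocks : ∀ r q, a 0 (r + q * B) ≤ a 0 r + ∑ m ∈ Finset.range q, a (r + m * B) B := by
    intro r q
    induction q with
    | zero => simp
    | succ q ih =>
      have := ha 0 (r + q * B) B
      rw [Finset.sum_range_succ, add_mul, one_mul, ← add_assoc]
      rw [zero_add] at this
      linarith
  have htail : ∀ m s, a 0 (m + s) ≤ a 0 m + ∑ k ∈ Finset.range s, b (m + k) := by
    intro m s
    induction s with
    | zero => simp
    | succ s ih =>
      have h1 := ha 0 (m + s) 1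
      have h2 := hab (m + s)
      rw [Finset.sum_range_succ, ← add_assoc]
      rw [zero_add] at h1
      linarith
  have hr : ∀ r ∈ Finset.range B, a 0 n ≤ a 0 r + ∑ m ∈ Finset.range q, a (r + m * B) B +
      (∑ k ∈ Finset.range n, b k - ∑ k ∈ Finset.range (q * B), b k) := by
    intro r hr
    rw [Finset.mem_range] at hr
    obtain ⟨s, rfl⟩ : ∃ s, n = r + q * B + s := Nat.exists_eq_add_of_le (by linarith)
    have h1 := htail (r + q * B) s
    have h2 := hblocks r q
    have h3 : ∑ k ∈ Finset.range (q * B), b k ≤ ∑ k ∈ Finset.range (r + q * B), b k :=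
      Finset.sum_le_sum_of_subset_of_nonneg (Finset.range_mono (by omega)) fun i _ _ => hb i
    rw [Finset.sum_range_add _ (r + q * B) s]
    linarith
  have := Finset.sum_le_sum hr
  simpa [Finset.sum_add_distrib, mul_sub, Finset.sum_range_mul_add (fun j => a j B)] using this

theorem tendsto_blocks_div {B : ℕ} (hB : 0 < B) :
    Tendsto (fun n : ℕ => (((n / B - 1) * B : ℕ) : ℝ) / n) atTop (𝓝 1) := by
  have hlim : Tendsto (fun n : ℕ => 1 - (2 * B : ℝ) / n) atTop (𝓝 (1 - 0)) :=
    tendsto_const_nhds.sub (tendsto_const_nhds.div_atTop tendsto_natCast_atTop_atTop)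
  rw [sub_zero] at hlim
  refine tendsto_of_tendsto_of_tendsto_of_le_of_le' hlim tendsto_const_nhds ?_ ?_
  · filter_upwards [eventually_gt_atTop 0] with n hn
    have hn0 : (0 : ℝ) < n := by exact_mod_cast hn
    rw [le_div_iff₀ hn0, sub_mul, div_mul_cancel₀ _ hn0.ne', one_mul, sub_le_iff_le_add]
    have h1 := Nat.div_add_mod n B
    have h2 := Nat.mod_lt n hB
    have : n ≤ (n / B - 1) * B + 2 * B := by
      rw [Nat.sub_mul, mul_comm]
      omega
    exact_mod_cast this
  · filter_upwards with n
    refine div_le_one_of_le₀ ?_ n.cast_nonneg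
    exact_mod_cast (Nat.mul_le_mul_right B (Nat.sub_le _ _)).trans (Nat.div_mul_le_self n B)

theorem tendsto_blocks_atTop {B : ℕ} (hB : 0 < B) :
    Tendsto (fun n : ℕ => (n / B - 1) * B) atTop atTop := by
  refine tendsto_atTop.2 fun M => ?_
  filter_upwards [eventually_ge_atTop (M + 2 * B)] with n hn
  have h1 := Nat.div_add_mod n B
  have h2 := Nat.mod_lt n hB
  rw [Nat.sub_mul, mul_comm]
  omega

/-- Upper bound of a subadditive cocycle by the mean of one of its blocks, for a single orbit. -/
theorem eventually_div_lt_of_block_mean {a : ℕ → ℕ → ℝ} {b : ℕ → ℝ} {B : ℕ} {p s c : ℝ}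
    (ha : ∀ j m n, a j (m + n) ≤ a j m + a (j + m) n) (hab : ∀ j, a j 1 ≤ b j)
    (hb : ∀ j, 0 ≤ b j) (hB : 0 < B)
    (hp : Tendsto (fun n : ℕ => (∑ j ∈ Finset.range n, a j B) / n) atTop (𝓝 p))
    (hs : Tendsto (fun n : ℕ => (∑ j ∈ Finset.range n, b j) / n) atTop (𝓝 s))
    (hc : p / B < c) : ∀ᶠ n : ℕ in atTop, a 0 n / n < c := by
  have hB' : (0 : ℝ) < B := by exact_mod_cast hB
  set N : ℕ → ℕ := fun n => (n / B - 1) * B with hN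
  have hNt : Tendsto N atTop atTop := tendsto_blocks_atTop hB
  have hsub : ∀ {u : ℕ → ℝ} {l : ℝ}, Tendsto (fun n : ℕ => u n / n) atTop (𝓝 l) →
      Tendsto (fun n : ℕ => u (N n) / n) atTop (𝓝 l) := by
    intro u l hu
    have h := (hu.comp hNt).mul (tendsto_blocks_div hB)
    rw [mul_one] at h
    refine h.congr' ?_
    filter_upwards [hNt.eventually_gt_atTop 0] with n hn
    have : (N n : ℝ) ≠ 0 := by exact_mod_cast hn.ne'
    simp only [Function.comp]
    rw [div_mul_div_cancel₀ this]
  have hlim : Tendsto (fun n : ℕ => (∑ r ∈ Finset.range B, a 0 r) / B / n +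
      (∑ j ∈ Finset.range (N n), a j B) / n / B +
      ((∑ k ∈ Finset.range n, b k) / n - (∑ k ∈ Finset.range (N n), b k) / n)) atTop
      (𝓝 (0 + p / B + (s - s))) :=
    ((tendsto_const_nhds.div_atTop tendsto_natCast_atTop_atTop).add
      ((hsub hp).div_const _)).add (hs.sub (hsub hs))
  rw [zero_add, sub_self, add_zero] at hlim
  filter_upwards [hlim.eventually (gt_mem_nhds hc), eventually_ge_atTop B] with n hn hBn
  refine lt_of_le_of_lt ?_ hn
  have hn0 : (0 : ℝ) < n := by exact_mod_cast hB.trans_le hBn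
  have hq : n / B - 1 + 1 = n / B := Nat.sub_add_cancel (Nat.div_pos hBn hB)
  have h := mul_le_block_sum ha hab hb B (n / B - 1) n (by rw [hq]; exact Nat.div_mul_le_self n B)
  rw [← hN] at *
  have e : (∑ r ∈ Finset.range B, a 0 r) / B / n + (∑ j ∈ Finset.range (N n), a j B) / n / B +
      ((∑ k ∈ Finset.range n, b k) / n - (∑ k ∈ Finset.range (N n), b k) / n) =
      (∑ r ∈ Finset.range B, a 0 r + ∑ j ∈ Finset.range (N n), a j B +
      B * (∑ k ∈ Finset.range n, b k - ∑ k ∈ Finset.range (N n), b k)) / (B * n) := by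
    field_simp
  rw [e, div_le_div_iff₀ hn0 (by positivity)]
  nlinarith [mul_le_mul_of_nonneg_right h hn0.le]

/-- The upper half of the subadditive ergodic theorem, for ergodic maps. -/
theorem Ergodic.ae_forall_eventually_subadditive_div_lt {X : Type*} [MeasurableSpace X]
    {μ : Measure X} [IsProbabilityMeasure μ] {T : X → X} (hT : Ergodic T μ) {W : ℕ → X → ℝ}
    (hW : ∀ n, Integrable (W n) μ)
    (hsub : ∀ᵐ x ∂μ, ∀ j m n, W (m + n) (T^[j] x) ≤ W m (T^[j] x) + W n (T^[j + m] x)) :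
    ∀ᵐ x ∂μ, ∀ B : ℕ, 0 < B → ∀ c, (∫ x, W B x ∂μ) / B < c →
      ∀ᶠ n : ℕ in atTop, W n x / n < c := by
  have h1 := ae_all_iff.2 fun B => hT.ae_tendsto_birkhoffSum_div (hW B)
  have h2 := hT.ae_tendsto_birkhoffSum_div (hW 1).pos_part
  filter_upwards [hsub, h1, h2] with x hx hB hb B hB0 c hc
  exact eventually_div_lt_of_block_mean (a := fun j n => W n (T^[j] x))
    (b := fun j => max (W 1 (T^[j] x)) 0) hx (fun j => le_max_left _ _) (fun j => le_max_right _ _)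
    hB0 (hB B) hb hc

section Network

variable {C : CField} {v₀ : ℝ} {L A : ℕ}

theorem nonnegField.shiftV (hC : nonnegField C) (k : ℤ) : nonnegField (shiftV k C) :=
  fun _ => hC _

@[simp]
theorem shiftV_zero (C : CField) : shiftV 0 C = C := by
  funext p
  simp [shiftV]

@[simp]
theorem shiftH_zero (C : CField) : shiftH 0 C = C := by
  funext p
  simp [shiftH]

theorem iterate_shiftV (n : ℕ) (C : CField) : (shiftV 1)^[n] C = shiftV n C := by
  induction n with
  | zero => simp
  | succ n ih =>
    rw [Function.iterate_succ_apply', ih]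
    funext p
    simp only [shiftV, Nat.cast_succ]
    congr 2
    ring

theorem iterate_shiftH (n : ℕ) (C : CField) : (shiftH 1)^[n] C = shiftH n C := by
  induction n with
  | zero => simp
  | succ n ih =>
    rw [Function.iterate_succ_apply', ih]
    funext p
    simp only [shiftH, Nat.cast_succ]
    congr 2
    ring

theorem shiftV_shiftV (k l : ℤ) (C : CField) : shiftV k (shiftV l C) = shiftV (l + k) C := by
  funext p
  simp only [shiftV]
  congr 2
  ring

theorem netEnergy_nonneg (hC : nonnegField C) (L A : ℕ) (φ : ℤ × ℤ → ℝ) :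
    0 ≤ netEnergy C L A φ :=
  add_nonneg
    (Finset.sum_nonneg fun _ _ => Finset.sum_nonneg fun _ _ => mul_nonneg (sq_nonneg _) (hC _).1)
    (Finset.sum_nonneg fun _ _ => Finset.sum_nonneg fun _ _ => mul_nonneg (sq_nonneg _) (hC _).2)

theorem obcOK_of_cbcOK {φ : ℤ × ℤ → ℝ} (h : cbcOK L A v₀ φ) : obcOK L A v₀ φ := by
  intro j hj
  have h0 := h 0 (by simp) j hj (by simp)
  have hL := h L (by simp) j hj (by simp)
  exact ⟨by simpa using h0, by simpa using hL⟩

theorem cbcOK_linear (L A : ℕ) (v₀ : ℝ) : cbcOK L A v₀ fun p => p.1 * v₀ := by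
  intro i _ j _ _
  simp

instance : Nonempty {φ : ℤ × ℤ → ℝ // cbcOK L A v₀ φ} := ⟨⟨_, cbcOK_linear L A v₀⟩⟩

instance : Nonempty {φ : ℤ × ℤ → ℝ // obcOK L A v₀ φ} :=
  ⟨⟨_, obcOK_of_cbcOK (cbcOK_linear L A v₀)⟩⟩

theorem WCBC_nonneg (hC : nonnegField C) : 0 ≤ WCBC C v₀ L A :=
  Real.iInf_nonneg fun _ => netEnergy_nonneg hC _ _ _

theorem WOBC_le_netEnergy (hC : nonnegField C) {φ : ℤ × ℤ → ℝ} (h : obcOK L A v₀ φ) :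
    WOBC C v₀ L A ≤ netEnergy C L A φ :=
  ciInf_le (f := fun φ : {φ : ℤ × ℤ → ℝ // obcOK L A v₀ φ} => netEnergy C L A φ.1)
    ⟨0, by rintro _ ⟨φ, rfl⟩; exact netEnergy_nonneg hC _ _ _⟩ ⟨φ, h⟩

theorem WCBC_le_netEnergy (hC : nonnegField C) {φ : ℤ × ℤ → ℝ} (h : cbcOK L A v₀ φ) :
    WCBC C v₀ L A ≤ netEnergy C L A φ :=
  ciInf_le (f := fun φ : {φ : ℤ × ℤ → ℝ // cbcOK L A v₀ φ} => netEnergy C L A φ.1)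
    ⟨0, by rintro _ ⟨φ, rfl⟩; exact netEnergy_nonneg hC _ _ _⟩ ⟨φ, h⟩

theorem WOBC_le_WCBC (hC : nonnegField C) : WOBC C v₀ L A ≤ WCBC C v₀ L A :=
  le_ciInf fun φ => WOBC_le_netEnergy hC (obcOK_of_cbcOK φ.2)

theorem WOBC_zero_right (C : CField) (v₀ : ℝ) (L : ℕ) : WOBC C v₀ L 0 = 0 := by
  simp [WOBC, netEnergy]

theorem WCBC_zero_right (C : CField) (v₀ : ℝ) (L : ℕ) : WCBC C v₀ L 0 = 0 := by
  simp [WCBC, netEnergy]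

/-- Cutting a rectangle into two stacked rectangles. -/
theorem netEnergy_add_rows (C : CField) (L a b : ℕ) (φ : ℤ × ℤ → ℝ) :
    netEnergy C L (a + 1 + (b + 1)) φ = netEnergy C L (a + 1) φ +
      netEnergy (shiftV ((a + 1 : ℕ) : ℤ) C) L (b + 1)
        (fun p => φ (p.1, p.2 + ((a + 1 : ℕ) : ℤ))) +
      ∑ i ∈ Finset.range (L + 1),
        (φ ((i : ℤ), (a : ℤ)) - φ ((i : ℤ), (a : ℤ) + 1)) ^ 2 * (C ((i : ℤ), (a : ℤ))).2 := by
  have h : a + 1 + (b + 1) - 1 = a + 1 + b := by omega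
  simp only [netEnergy, h, Finset.sum_range_add _ (a + 1), Finset.sum_range_succ _ a,
    Nat.add_sub_cancel, Finset.sum_add_distrib, shiftV]
  push_cast
  have e : ∀ x : ℕ, (x : ℤ) + 1 + (a + 1) = a + 1 + x + 1 := fun x => by ring
  have e' : ∀ x : ℕ, (x : ℤ) + (a + 1) = a + 1 + x := fun x => by ring
  simp only [e, e']
  ring

theorem add_le_WOBC_add_rows (hC : nonnegField C) (m n : ℕ) :
    WOBC C v₀ L m + WOBC (shiftV m C) v₀ L n ≤ WOBC C v₀ L (m + n) := by
  rcases m with _ | a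
  · simp [WOBC_zero_right]
  rcases n with _ | b
  · simp [WOBC_zero_right]
  refine le_ciInf fun φ => ?_
  rw [netEnergy_add_rows]
  have h1 : obcOK L (a + 1) v₀ φ.1 := fun j hj =>
    φ.2 j (Finset.mem_range.2 (by have := Finset.mem_range.1 hj; omega))
  have h2 : obcOK L (b + 1) v₀ (fun p => φ.1 (p.1, p.2 + ((a + 1 : ℕ) : ℤ))) := by
    intro j hj
    have := φ.2 (j + (a + 1)) (Finset.mem_range.2 (by have := Finset.mem_range.1 hj; omega))
    simpa using this
  have h3 := WOBC_le_netEnergy hC h1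
  have h4 := WOBC_le_netEnergy (hC.shiftV ((a + 1 : ℕ) : ℤ)) h2
  have h5 : 0 ≤ ∑ i ∈ Finset.range (L + 1),
      (φ.1 ((i : ℤ), (a : ℤ)) - φ.1 ((i : ℤ), (a : ℤ) + 1)) ^ 2 * (C ((i : ℤ), (a : ℤ))).2 :=
    Finset.sum_nonneg fun _ _ => mul_nonneg (sq_nonneg _) (hC _).2
  linarith

/-- The energy depends only on the values of the potential on the rectangle. -/
theorem netEnergy_congr {φ ψ : ℤ × ℤ → ℝ}
    (h : ∀ i j : ℕ, i ≤ L → j < A → φ ((i : ℤ), (j : ℤ)) = ψ ((i : ℤ), (j : ℤ))) :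
    netEnergy C L A φ = netEnergy C L A ψ := by
  unfold netEnergy
  congr 1 <;> refine Finset.sum_congr rfl fun i hi => Finset.sum_congr rfl fun j hj => ?_ <;>
    rw [Finset.mem_range] at hi hj
  · have h1 := h i j hi.le hj
    have h2 := h (i + 1) j hi hj
    push_cast at h2
    rw [h1, h2]
  · have h1 := h i j (by omega) (by omega)
    have h2 := h i (j + 1) (by omega) (by omega)
    push_cast at h2
    rw [h1, h2]

theorem WCBC_add_rows_le (hC : nonnegField C) (m n : ℕ) :
    WCBC C v₀ L (m + n) ≤ WCBC C v₀ L m + WCBC (shiftV m C) v₀ L n := by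
  rcases m with _ | a
  · simp [WCBC_zero_right]
  rcases n with _ | b
  · simp [WCBC_zero_right]
  refine le_ciInf_add_ciInf fun φ ψ => ?_
  set χ : ℤ × ℤ → ℝ := fun p =>
    if p.2 < (a + 1 : ℕ) then φ.1 p else ψ.1 (p.1, p.2 - (a + 1 : ℕ)) with hχ
  have hlow : ∀ i j : ℕ, j < a + 1 → χ ((i : ℤ), (j : ℤ)) = φ.1 ((i : ℤ), (j : ℤ)) := by
    intro i j hj
    simp only [hχ]
    rw [if_pos (by exact_mod_cast hj)]
  have hhigh : ∀ i j : ℕ, χ ((i : ℤ), (j : ℤ) + (a + 1 : ℕ)) = ψ.1 ((i : ℤ), (j : ℤ)) := by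
    intro i j
    simp only [hχ]
    rw [if_neg (by omega), add_sub_cancel_right]
  have hok : cbcOK L (a + 1 + (b + 1)) v₀ χ := by
    intro i hi j hj hb
    rw [Finset.mem_range] at hj
    rcases lt_or_ge j (a + 1) with h | h
    · rw [hlow i j h]
      exact φ.2 i hi j (Finset.mem_range.2 h) (by omega)
    · obtain ⟨k, rfl⟩ := Nat.exists_eq_add_of_le' h
      rw [Nat.cast_add, hhigh]
      exact ψ.2 i hi k (Finset.mem_range.2 (by omega)) (by omega)
  refine (WCBC_le_netEnergy hC hok).trans (le_of_eq ?_)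
  rw [netEnergy_add_rows, netEnergy_congr (φ := χ) (ψ := φ.1) fun i j _ hj => hlow i j hj,
    netEnergy_congr (φ := fun p => χ (p.1, p.2 + ((a + 1 : ℕ) : ℤ))) (ψ := ψ.1)
      fun i j _ _ => hhigh i j, add_eq_left]
  refine Finset.sum_eq_zero fun i hi => ?_
  have h1 := φ.2 i hi a (by simp) (by simp)
  have h2 := ψ.2 i hi 0 (by simp) (by simp)
  rw [← hlow i a (by omega)] at h1
  rw [← hhigh i 0] at h2
  have e : ((0 : ℕ) : ℤ) + ((a + 1 : ℕ) : ℤ) = a + 1 := by push_cast; ring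
  rw [e] at h2
  rw [h1, h2]
  ring

theorem WCBC_add_columns_le (hC : nonnegField C) (K L A : ℕ) :
    WCBC C v₀ (K + L) A ≤ WCBC C v₀ K A + WCBC (shiftH K C) v₀ L A := by
  refine le_ciInf_add_ciInf fun φ ψ => ?_
  set χ : ℤ × ℤ → ℝ := fun p =>
    if p.1 ≤ K then φ.1 p else ψ.1 (p.1 - K, p.2) + K * v₀ with hχ
  have hleft : ∀ i j : ℕ, i ≤ K → χ ((i : ℤ), (j : ℤ)) = φ.1 ((i : ℤ), (j : ℤ)) := by
    intro i j hi
    simp only [hχ]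
    rw [if_pos (by exact_mod_cast hi)]
  have hright : ∀ i j : ℕ, j < A → χ ((K : ℤ) + i, (j : ℤ)) = ψ.1 ((i : ℤ), (j : ℤ)) + K * v₀ := by
    intro i j hj
    rcases i.eq_zero_or_pos with rfl | hi
    · have h1 := (obcOK_of_cbcOK φ.2 j (Finset.mem_range.2 hj)).2
      have h2 := (obcOK_of_cbcOK ψ.2 j (Finset.mem_range.2 hj)).1
      rw [Nat.cast_zero, add_zero, h2, zero_add, ← h1, hleft K j le_rfl]
    · simp only [hχ]
      rw [if_neg (by omega), add_sub_cancel_left]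
  have hok : cbcOK (K + L) A v₀ χ := by
    intro i hi j hj hb
    rw [Finset.mem_range] at hi
    rcases le_or_gt i K with h | h
    · rw [hleft i j h]
      exact φ.2 i (Finset.mem_range.2 (by omega)) j hj (by omega)
    · obtain ⟨k, rfl⟩ := Nat.exists_eq_add_of_le h.le
      rw [Nat.cast_add, hright k j (Finset.mem_range.1 hj),
        ψ.2 k (Finset.mem_range.2 (by omega)) j hj (by omega)]
      push_cast
      ring
  refine (WCBC_le_netEnergy hC hok).trans ?_
  rw [← netEnergy_congr (C := C) (φ := χ) (ψ := φ.1) fun i j hi _ => hleft i j hi]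
  have hlong : ∑ i ∈ Finset.range L, ∑ j ∈ Finset.range A,
      (χ (((K + i : ℕ) : ℤ), (j : ℤ)) - χ (((K + i : ℕ) : ℤ) + 1, (j : ℤ))) ^ 2 *
        (C (((K + i : ℕ) : ℤ), (j : ℤ))).1 =
      ∑ i ∈ Finset.range L, ∑ j ∈ Finset.range A,
      (ψ.1 ((i : ℤ), (j : ℤ)) - ψ.1 ((i : ℤ) + 1, (j : ℤ))) ^ 2 *
        (shiftH K C ((i : ℤ), (j : ℤ))).1 := by
    refine Finset.sum_congr rfl fun i _ => Finset.sum_congr rfl fun j hj => ?_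
    have h1 := hright i j (Finset.mem_range.1 hj)
    have h2 := hright (i + 1) j (Finset.mem_range.1 hj)
    push_cast at h2 ⊢
    rw [add_assoc, h1, h2, shiftH, add_comm (i : ℤ) K]
    ring
  have htrans : ∑ i ∈ Finset.range L, ∑ j ∈ Finset.range (A - 1),
      (χ (((K + 1 + i : ℕ) : ℤ), (j : ℤ)) - χ (((K + 1 + i : ℕ) : ℤ), (j : ℤ) + 1)) ^ 2 *
        (C (((K + 1 + i : ℕ) : ℤ), (j : ℤ))).2 =
      ∑ i ∈ Finset.range L, ∑ j ∈ Finset.range (A - 1),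
      (ψ.1 (((i + 1 : ℕ) : ℤ), (j : ℤ)) - ψ.1 (((i + 1 : ℕ) : ℤ), (j : ℤ) + 1)) ^ 2 *
        (shiftH K C (((i + 1 : ℕ) : ℤ), (j : ℤ))).2 := by
    refine Finset.sum_congr rfl fun i _ => Finset.sum_congr rfl fun j hj => ?_
    rw [Finset.mem_range] at hj
    have h1 := hright (i + 1) j (by omega)
    have h2 := hright (i + 1) (j + 1) (by omega)
    have e : ((K + 1 + i : ℕ) : ℤ) = K + ((i + 1 : ℕ) : ℤ) := by push_cast; ring
    rw [Nat.cast_succ j] at h2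
    rw [e, h1, h2, shiftH, add_comm ((i + 1 : ℕ) : ℤ) K]
    ring
  have hfirst : 0 ≤ ∑ j ∈ Finset.range (A - 1),
      (ψ.1 (((0 : ℕ) : ℤ), (j : ℤ)) - ψ.1 (((0 : ℕ) : ℤ), (j : ℤ) + 1)) ^ 2 *
        (shiftH K C (((0 : ℕ) : ℤ), (j : ℤ))).2 :=
    Finset.sum_nonneg fun _ _ => mul_nonneg (sq_nonneg _) (hC _).2
  rw [netEnergy, netEnergy, netEnergy, Finset.sum_range_add _ K L, hlong,
    show K + L + 1 = K + 1 + L by ring, Finset.sum_range_add _ (K + 1) L, htrans,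
    Finset.sum_range_succ' _ L]
  linarith

/-- Contribution of the first and last row to the comparison of the boundary conditions. -/
def boundaryCost (C : CField) (v₀ : ℝ) (L m : ℕ) : ℝ :=
  (∑ i ∈ Finset.range L, v₀ ^ 2 *
    ((C ((i : ℤ), ((0 : ℕ) : ℤ))).1 + (C ((i : ℤ), ((m + 1 : ℕ) : ℤ))).1)) +
  ∑ i ∈ Finset.range (L + 1), (L * v₀) ^ 2 *
    ((C ((i : ℤ), ((0 : ℕ) : ℤ))).2 + (C ((i : ℤ), (m : ℤ))).2)

theorem sq_clamp_sub_clamp_le (a b M : ℝ) :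
    (max 0 (min a M) - max 0 (min b M)) ^ 2 ≤ (a - b) ^ 2 := by
  rw [max_comm 0, max_comm 0]
  refine sq_le_sq.2 ((abs_max_sub_max_le_abs _ _ _).trans ?_)
  simpa using abs_min_sub_min_le_max a M b M

theorem sq_sub_le_of_mem_Icc {a b M : ℝ} (ha : 0 ≤ a ∧ a ≤ M) (hb : 0 ≤ b ∧ b ≤ M) :
    (a - b) ^ 2 ≤ M ^ 2 :=
  sq_le_sq' (by linarith) (by linarith)

/-- A potential with open boundary conditions can be clamped to the range of its end values and
made linear on the first and last row at bounded cost. -/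
theorem WCBC_le_WOBC_add (hC : nonnegField C) (hv₀ : 0 ≤ v₀) (L m : ℕ) :
    WCBC C v₀ L (m + 2) ≤ WOBC C v₀ L (m + 2) + boundaryCost C v₀ L m := by
  rw [← sub_le_iff_le_add]
  refine le_ciInf fun φ => ?_
  rw [sub_le_iff_le_add]
  set cl : ℤ × ℤ → ℝ := fun p => max 0 (min (φ.1 p) (L * v₀)) with hcl
  set χ : ℤ × ℤ → ℝ := fun p => if p.2 = 0 ∨ p.2 = m + 1 then p.1 * v₀ else cl p with hχ
  have hM : 0 ≤ L * v₀ := by positivity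
  have hχb : ∀ (i : ℕ) (y : ℤ), i ≤ L → 0 ≤ χ ((i : ℤ), y) ∧ χ ((i : ℤ), y) ≤ L * v₀ := by
    intro i y hi
    simp only [hχ, hcl]
    split_ifs
    · push_cast
      have : (i : ℝ) ≤ L := by exact_mod_cast hi
      exact ⟨by positivity, by gcongr⟩
    · exact ⟨le_max_left _ _, max_le hM (min_le_right _ _)⟩
  have hχcl : ∀ (x : ℤ) (j : ℕ), ¬ (j = 0 ∨ j = m + 1) → χ (x, (j : ℤ)) = cl (x, (j : ℤ)) := by
    intro x j hj
    simp only [hχ]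
    rw [if_neg (by omega)]
  have hok : cbcOK L (m + 2) v₀ χ := by
    intro i hi j hj hb
    by_cases hj' : j = 0 ∨ j = m + 1
    · simp only [hχ]
      rw [if_pos (by omega)]
      simp
    · rw [hχcl _ _ hj']
      simp only [hcl]
      rcases hb with rfl | rfl | h | h
      · have := (φ.2 j hj).1
        simp [this, hM]
      · have := (φ.2 j hj).2
        simp [this, hM]
      · exact absurd (Or.inl h) hj'
      · exact absurd (Or.inr (by omega)) hj'
  refine (WCBC_le_netEnergy hC hok).trans ?_
  have hlong : ∀ i ∈ Finset.range L, ∑ j ∈ Finset.range (m + 2),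
      (χ ((i : ℤ), (j : ℤ)) - χ ((i : ℤ) + 1, (j : ℤ))) ^ 2 * (C ((i : ℤ), (j : ℤ))).1 ≤
      ∑ j ∈ Finset.range (m + 2), (φ.1 ((i : ℤ), (j : ℤ)) - φ.1 ((i : ℤ) + 1, (j : ℤ))) ^ 2 *
        (C ((i : ℤ), (j : ℤ))).1 +
      v₀ ^ 2 * ((C ((i : ℤ), ((0 : ℕ) : ℤ))).1 + (C ((i : ℤ), ((m + 1 : ℕ) : ℤ))).1) := by
    intro i _
    have : ∀ j ∈ Finset.range (m + 2),
        (χ ((i : ℤ), (j : ℤ)) - χ ((i : ℤ) + 1, (j : ℤ))) ^ 2 * (C ((i : ℤ), (j : ℤ))).1 ≤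
        (φ.1 ((i : ℤ), (j : ℤ)) - φ.1 ((i : ℤ) + 1, (j : ℤ))) ^ 2 * (C ((i : ℤ), (j : ℤ))).1 +
        ((if 0 = j then v₀ ^ 2 * (C ((i : ℤ), (j : ℤ))).1 else 0) +
          if m + 1 = j then v₀ ^ 2 * (C ((i : ℤ), (j : ℤ))).1 else 0) := by
      intro j _
      have hCj := (hC ((i : ℤ), (j : ℤ))).1
      by_cases hj : j = 0 ∨ j = m + 1
      · have e : (χ ((i : ℤ), (j : ℤ)) - χ ((i : ℤ) + 1, (j : ℤ))) ^ 2 = v₀ ^ 2 := by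
          simp only [hχ]
          rw [if_pos (by omega), if_pos (by omega)]
          push_cast
          ring
        rw [e]
        have h1 : 0 ≤ v₀ ^ 2 * (C ((i : ℤ), (j : ℤ))).1 := by positivity
        have h2 : 0 ≤ (φ.1 ((i : ℤ), (j : ℤ)) - φ.1 ((i : ℤ) + 1, (j : ℤ))) ^ 2 *
          (C ((i : ℤ), (j : ℤ))).1 := by positivity
        split_ifs <;> first | linarith | omega
      · rw [hχcl _ _ hj, hχcl _ _ hj, if_neg (by omega), if_neg (by omega), add_zero, add_zero]
        exact mul_le_mul_of_nonneg_right (sq_clamp_sub_clamp_le _ _ _) hCj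
    refine (Finset.sum_le_sum this).trans (le_of_eq ?_)
    rw [Finset.sum_add_distrib, Finset.sum_add_distrib, Finset.sum_ite_eq, Finset.sum_ite_eq,
      if_pos (by simp), if_pos (by simp)]
    ring
  have htrans : ∀ i ∈ Finset.range (L + 1), ∑ j ∈ Finset.range (m + 1),
      (χ ((i : ℤ), (j : ℤ)) - χ ((i : ℤ), (j : ℤ) + 1)) ^ 2 * (C ((i : ℤ), (j : ℤ))).2 ≤
      ∑ j ∈ Finset.range (m + 1), (φ.1 ((i : ℤ), (j : ℤ)) - φ.1 ((i : ℤ), (j : ℤ) + 1)) ^ 2 *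
        (C ((i : ℤ), (j : ℤ))).2 +
      (L * v₀) ^ 2 * ((C ((i : ℤ), ((0 : ℕ) : ℤ))).2 + (C ((i : ℤ), (m : ℤ))).2) := by
    intro i hi
    have hi' : i ≤ L := Nat.lt_succ_iff.1 (Finset.mem_range.1 hi)
    have : ∀ j ∈ Finset.range (m + 1),
        (χ ((i : ℤ), (j : ℤ)) - χ ((i : ℤ), (j : ℤ) + 1)) ^ 2 * (C ((i : ℤ), (j : ℤ))).2 ≤
        (φ.1 ((i : ℤ), (j : ℤ)) - φ.1 ((i : ℤ), (j : ℤ) + 1)) ^ 2 * (C ((i : ℤ), (j : ℤ))).2 +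
        ((if 0 = j then (L * v₀) ^ 2 * (C ((i : ℤ), (j : ℤ))).2 else 0) +
          if m = j then (L * v₀) ^ 2 * (C ((i : ℤ), (j : ℤ))).2 else 0) := by
      intro j hjm
      rw [Finset.mem_range] at hjm
      have hCj := (hC ((i : ℤ), (j : ℤ))).2
      by_cases hj : j = 0 ∨ j = m
      · have h0 := mul_le_mul_of_nonneg_right
          (sq_sub_le_of_mem_Icc (hχb i j hi') (hχb i (j + 1) hi')) hCj
        have h1 : 0 ≤ (L * v₀) ^ 2 * (C ((i : ℤ), (j : ℤ))).2 := by positivity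
        have h2 : 0 ≤ (φ.1 ((i : ℤ), (j : ℤ)) - φ.1 ((i : ℤ), (j : ℤ) + 1)) ^ 2 *
          (C ((i : ℤ), (j : ℤ))).2 := by positivity
        split_ifs <;> first | linarith | omega
      · have h1 := hχcl i (j + 1) (by omega)
        rw [Nat.cast_succ] at h1
        rw [hχcl _ _ (by omega), h1, if_neg (by omega), if_neg (by omega), add_zero, add_zero]
        exact mul_le_mul_of_nonneg_right (sq_clamp_sub_clamp_le _ _ _) hCj
    refine (Finset.sum_le_sum this).trans (le_of_eq ?_)
    rw [Finset.sum_add_distrib, Finset.sum_add_distrib, Finset.sum_ite_eq, Finset.sum_ite_eq,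
      if_pos (by simp), if_pos (by simp)]
    ring
  have h1 := Finset.sum_le_sum hlong
  have h2 := Finset.sum_le_sum htrans
  rw [Finset.sum_add_distrib] at h1 h2
  have e : m + 2 - 1 = m + 1 := rfl
  rw [netEnergy, netEnergy, boundaryCost, e]
  linarith

end Network

section Expectation

variable {μ : Measure CField} {v₀ : ℝ}

theorem integral_WCBC_add_rows_le (hV : MeasurePreserving (shiftV 1) μ μ)
    (hnn : ∀ᵐ C ∂μ, nonnegField C) (hint : ∀ L A, Integrable (fun C => WCBC C v₀ L A) μ)
    (L : ℕ) : Subadditive fun A => ∫ C, WCBC C v₀ L A ∂μ := by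
  intro m n
  have hTm := hV.iterate m
  have hi : Integrable (fun C => WCBC ((shiftV 1)^[m] C) v₀ L n) μ :=
    hTm.integrable_comp_of_integrable (hint L n)
  calc ∫ C, WCBC C v₀ L (m + n) ∂μ
      ≤ ∫ C, (WCBC C v₀ L m + WCBC ((shiftV 1)^[m] C) v₀ L n) ∂μ := by
        refine integral_mono_ae (hint _ _) ((hint L m).add hi) ?_
        filter_upwards [hnn] with C hC
        rw [iterate_shiftV]
        exact WCBC_add_rows_le hC m n
    _ = _ := by
        rw [integral_add (hint L m) hi, hTm.integral_comp_of_integrable (hint L n)]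

theorem integral_WCBC_add_columns_le (hH : MeasurePreserving (shiftH 1) μ μ)
    (hnn : ∀ᵐ C ∂μ, nonnegField C) (hint : ∀ L A, Integrable (fun C => WCBC C v₀ L A) μ)
    (K L A : ℕ) :
    ∫ C, WCBC C v₀ (K + L) A ∂μ ≤ ∫ C, WCBC C v₀ K A ∂μ + ∫ C, WCBC C v₀ L A ∂μ := by
  have hTK := hH.iterate K
  have hi : Integrable (fun C => WCBC ((shiftH 1)^[K] C) v₀ L A) μ :=
    hTK.integrable_comp_of_integrable (hint L A)
  calc ∫ C, WCBC C v₀ (K + L) A ∂μ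
      ≤ ∫ C, (WCBC C v₀ K A + WCBC ((shiftH 1)^[K] C) v₀ L A) ∂μ := by
        refine integral_mono_ae (hint _ _) ((hint K A).add hi) ?_
        filter_upwards [hnn] with C hC
        rw [iterate_shiftH]
        exact WCBC_add_columns_le hC K L A
    _ = _ := by
        rw [integral_add (hint K A) hi, hTK.integral_comp_of_integrable (hint L A)]

theorem integrable_and_integral_eq_apply_zero {f : ℝ × ℝ → ℝ}
    (hH : MeasurePreserving (shiftH 1) μ μ) (hV : MeasurePreserving (shiftV 1) μ μ)
    (hf : Integrable (fun C : CField => f (C 0)) μ) (i j : ℕ) :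
    Integrable (fun C : CField => f (C ((i : ℤ), (j : ℤ)))) μ ∧
      ∫ C, f (C ((i : ℤ), (j : ℤ))) ∂μ = ∫ C, f (C 0) ∂μ := by
  have hT := (hH.iterate i).comp (hV.iterate j)
  have e : ∀ C : CField, ((shiftH 1)^[i] ∘ (shiftV 1)^[j]) C 0 = C ((i : ℤ), (j : ℤ)) := by
    intro C
    simp [iterate_shiftH, iterate_shiftV, shiftH, shiftV]
  have h1 := hT.integrable_comp_of_integrable hf
  have h2 := hT.integral_comp_of_integrable hf
  simp only [e] at h2
  refine ⟨h1.congr (ae_of_all _ fun C => ?_), h2⟩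
  simp only [← e]
  rfl

theorem exists_integral_WCBC_le (hH : MeasurePreserving (shiftH 1) μ μ)
    (hV : MeasurePreserving (shiftV 1) μ μ) (hnn : ∀ᵐ C ∂μ, nonnegField C)
    (hmean₁ : Integrable (fun C : CField => (C 0).1) μ)
    (hmean₂ : Integrable (fun C : CField => (C 0).2) μ) (hv₀ : 0 ≤ v₀)
    (hintO : ∀ L A, Integrable (fun C => WOBC C v₀ L A) μ)
    (hintC : ∀ L A, Integrable (fun C => WCBC C v₀ L A) μ) (L : ℕ) :
    ∃ K, ∀ m, ∫ C, WCBC C v₀ L (m + 2) ∂μ ≤ ∫ C, WOBC C v₀ L (m + 2) ∂μ + K := by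
  have h1 := integrable_and_integral_eq_apply_zero (f := Prod.fst) hH hV hmean₁
  have h2 := integrable_and_integral_eq_apply_zero (f := Prod.snd) hH hV hmean₂
  have hi1 := fun m i (_ : i ∈ Finset.range L) =>
    ((h1 i 0).1.add (h1 i (m + 1)).1).const_mul (v₀ ^ 2)
  have hi2 := fun m i (_ : i ∈ Finset.range (L + 1)) =>
    ((h2 i 0).1.add (h2 i m).1).const_mul ((L * v₀) ^ 2)
  have hb : ∀ m, Integrable (fun C => boundaryCost C v₀ L m) μ := fun m =>
    (integrable_finsetSum _ (hi1 m)).add (integrable_finsetSum _ (hi2 m))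
  have hbc : ∀ m, ∫ C, boundaryCost C v₀ L m ∂μ = ∫ C, boundaryCost C v₀ L 0 ∂μ := by
    have : ∀ m, ∫ C, boundaryCost C v₀ L m ∂μ =
        (∑ i ∈ Finset.range L, v₀ ^ 2 * (∫ C, (C 0).1 ∂μ + ∫ C, (C 0).1 ∂μ)) +
        ∑ i ∈ Finset.range (L + 1), (L * v₀) ^ 2 * (∫ C, (C 0).2 ∂μ + ∫ C, (C 0).2 ∂μ) := by
      intro m
      refine (integral_add (integrable_finsetSum _ (hi1 m))
        (integrable_finsetSum _ (hi2 m))).trans ?_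
      rw [integral_finsetSum _ (hi1 m), integral_finsetSum _ (hi2 m)]
      congr 1 <;> refine Finset.sum_congr rfl fun i _ => ?_
      · rw [integral_const_mul]
        congr 1
        exact (integral_add (h1 i 0).1 (h1 i (m + 1)).1).trans
          (congrArg₂ _ (h1 i 0).2 (h1 i (m + 1)).2)
      · rw [integral_const_mul]
        congr 1
        exact (integral_add (h2 i 0).1 (h2 i m).1).trans (congrArg₂ _ (h2 i 0).2 (h2 i m).2)
    intro m
    rw [this m, this 0]
  refine ⟨∫ C, boundaryCost C v₀ L 0 ∂μ, fun m => ?_⟩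
  rw [← hbc m, ← integral_add (hintO _ _) (hb m)]
  refine integral_mono_ae (hintC _ _) ((hintO _ _).add (hb m)) ?_
  filter_upwards [hnn] with C hC
  exact WCBC_le_WOBC_add hC hv₀ L m

theorem bddBelow_range_div {u : ℕ → ℝ} (hu : ∀ n, 0 ≤ u n) :
    BddBelow (Set.range fun n : ℕ => u n / n) :=
  ⟨0, by rintro _ ⟨n, rfl⟩; exact div_nonneg (hu n) n.cast_nonneg⟩

end Expectation

/-- **Thermodynamic limit of the dissipation per unit volume, independence of
the boundary conditions.**  For i.i.d. nonnegative conductances with finite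
mean (modelled by a probability measure on conductance fields which is
preserved and ergodic under both lattice shifts), the iterated limit
`lim_{L→∞} lim_{A→∞} W_{L,A}/(L A)` exists almost surely, is finite, equals
`v₀² c̄^CBC`, and is independent of whether open or closed boundary conditions
are used, where `v₀² c̄^CBC = lim_{L→∞} lim_{A→∞} E(W^CBC_{L,A})/(L A)`. -/
theorem dissipation_thermodynamic_limit_BC_independent
    (μ : Measure CField) [IsProbabilityMeasure μ]
    (hstatH : MeasurePreserving (shiftH 1) μ μ)
    (hstatV : MeasurePreserving (shiftV 1) μ μ)
    (hergH : Ergodic (shiftH 1) μ) (hergV : Ergodic (shiftV 1) μ)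
    (hnn : ∀ᵐ C ∂μ, nonnegField C)
    (hmean₁ : Integrable (fun C : CField => (C 0).1) μ)
    (hmean₂ : Integrable (fun C : CField => (C 0).2) μ)
    (v₀ : ℝ) (hv₀ : 0 < v₀)
    (hintO : ∀ L A, Integrable (fun C => WOBC C v₀ L A) μ)
    (hintC : ∀ L A, Integrable (fun C => WCBC C v₀ L A) μ) :
    ∃ cbar : ℝ, ∃ w : ℕ → ℝ,
      -- `w L` is the limit as `A → ∞` of `E(W^CBC_{L,A})/(L A)`, and
      -- `v₀² c̄^CBC = lim_{L→∞} lim_{A→∞} E(W^CBC_{L,A})/(L A)`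
      (∀ L, 1 ≤ L → Tendsto
        (fun A : ℕ => (∫ C, WCBC C v₀ L A ∂μ) / ((L : ℝ) * A)) atTop (𝓝 (w L))) ∧
      Tendsto w atTop (𝓝 (v₀^2 * cbar)) ∧
      -- almost surely, for both boundary conditions, the inner limit in `A`
      -- exists and equals the deterministic value `w L`, whence
      -- `lim_{L→∞} lim_{A→∞} W_{L,A}/(L A) = v₀² c̄^CBC` a.s.
      (∀ᵐ C ∂μ, ∀ L, 1 ≤ L →
        Tendsto (fun A : ℕ => WCBC C v₀ L A / ((L : ℝ) * A)) atTop (𝓝 (w L)) ∧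
        Tendsto (fun A : ℕ => WOBC C v₀ L A / ((L : ℝ) * A)) atTop (𝓝 (w L))) := by
  have hCnn : ∀ L A, 0 ≤ ∫ C, WCBC C v₀ L A ∂μ := fun L A =>
    integral_nonneg_of_ae (hnn.mono fun C hC => WCBC_nonneg hC)
  have hrow := integral_WCBC_add_rows_le hstatV hnn hintC
  set g : ℕ → ℝ := fun L => (hrow L).lim with hg
  have hgC : ∀ L, Tendsto (fun A : ℕ => (∫ C, WCBC C v₀ L A ∂μ) / A) atTop (𝓝 (g L)) :=
    fun L => (hrow L).tendsto_lim (bddBelow_range_div (hCnn L))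
  have hg0 : ∀ L, 0 ≤ g L := fun L =>
    ge_of_tendsto' (hgC L) fun A => div_nonneg (hCnn L A) A.cast_nonneg
  have hgsub : Subadditive g := by
    intro K L
    refine le_of_tendsto_of_tendsto' (hgC (K + L)) ((hgC K).add (hgC L)) fun A => ?_
    rw [← add_div]
    exact div_le_div_of_nonneg_right (integral_WCBC_add_columns_le hstatH hnn hintC K L A)
      A.cast_nonneg
  have hgO : ∀ L, Tendsto (fun A : ℕ => (∫ C, WOBC C v₀ L A ∂μ) / A) atTop (𝓝 (g L)) := by
    intro L
    obtain ⟨K, hK⟩ := exists_integral_WCBC_le hstatH hstatV hnn hmean₁ hmean₂ hv₀.le hintO hintC L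
    have hlow := (hgC L).sub (tendsto_const_nhds (x := K).div_atTop tendsto_natCast_atTop_atTop)
    rw [sub_zero] at hlow
    refine tendsto_of_tendsto_of_tendsto_of_le_of_le' hlow (hgC L) ?_ ?_
    · filter_upwards [eventually_ge_atTop 2] with A hA
      obtain ⟨m, rfl⟩ := Nat.exists_eq_add_of_le' hA
      rw [← sub_div]
      exact div_le_div_of_nonneg_right (by linarith [hK m]) (Nat.cast_nonneg _)
    · filter_upwards with A
      exact div_le_div_of_nonneg_right (integral_mono_ae (hintO _ _) (hintC _ _)
        (hnn.mono fun C hC => WOBC_le_WCBC hC)) A.cast_nonneg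
  have hlimC := ae_all_iff.2 fun L =>
    hergV.ae_forall_eventually_subadditive_div_lt (W := fun A C => WCBC C v₀ L A) (hintC L) (by
      filter_upwards [hnn] with C hC j m n
      have := WCBC_add_rows_le (v₀ := v₀) (L := L) (hC.shiftV j) m n
      rwa [shiftV_shiftV, ← Nat.cast_add, ← iterate_shiftV, ← iterate_shiftV] at this)
  have hlimO := ae_all_iff.2 fun L =>
    hergV.ae_forall_eventually_subadditive_div_lt (W := fun A C => - WOBC C v₀ L A)
      (fun A => (hintO L A).neg) (by
      filter_upwards [hnn] with C hC j m n
      have := add_le_WOBC_add_rows (v₀ := v₀) (L := L) (hC.shiftV j) m n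
      rw [shiftV_shiftV, ← Nat.cast_add, ← iterate_shiftV, ← iterate_shiftV] at this
      linarith)
  refine ⟨hgsub.lim / v₀ ^ 2, fun L => g L / L, fun L _ => ?_, ?_, ?_⟩
  · refine ((hgC L).div_const (L : ℝ)).congr fun A => ?_
    rw [div_div, mul_comm]
  · rw [mul_div_cancel₀ _ (by positivity)]
    exact hgsub.tendsto_lim (bddBelow_range_div hg0)
  · filter_upwards [hnn, hlimC, hlimO] with C hC hCu hOl L _
    have hle : ∀ A : ℕ, WOBC C v₀ L A / A ≤ WCBC C v₀ L A / A := fun A =>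
      div_le_div_of_nonneg_right (WOBC_le_WCBC hC) A.cast_nonneg
    have hup : ∀ c, g L < c → ∀ᶠ A : ℕ in atTop, WCBC C v₀ L A / A < c := by
      intro c hc
      obtain ⟨B, hB, hB0⟩ := (((hgC L).eventually (gt_mem_nhds hc)).and
        (eventually_gt_atTop 0)).exists
      exact hCu L B hB0 c hB
    have hlo : ∀ c, c < g L → ∀ᶠ A : ℕ in atTop, c < WOBC C v₀ L A / A := by
      intro c hc
      obtain ⟨B, hB, hB0⟩ := (((hgO L).eventually (lt_mem_nhds hc)).and
        (eventually_gt_atTop 0)).exists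
      filter_upwards [hOl L B hB0 (-c) (by rw [integral_neg, neg_div]; linarith)] with A hA
      rw [neg_div] at hA
      linarith
    have hscale : ∀ W : ℕ → ℝ, Tendsto (fun A : ℕ => W A / A) atTop (𝓝 (g L)) →
        Tendsto (fun A : ℕ => W A / ((L : ℝ) * A)) atTop (𝓝 (g L / L)) := fun W hW =>
      (hW.div_const (L : ℝ)).congr fun A => by rw [div_div, mul_comm]
    exact ⟨hscale _ (tendsto_order.2
        ⟨fun c hc => (hlo c hc).mono fun A hA => hA.trans_le (hle A), hup⟩),
      hscale _ (tendsto_order.2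
        ⟨hlo, fun c hc => (hup c hc).mono fun A hA => (hle A).trans_lt hA⟩)⟩
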